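/- Consider the CycIP setup in X = ℝⁿ (or any finite-dimensional real Hilbert space), and suppose that ⋂_{i∈I₁} C_i ∩ ⋂_{i∈I₀} int C_i ≠ ∅ and that the control is quasicyclic with some quasiperiod M ≥ 1. Then the sequence generated by x_{k+1} := T_{i(k)} x_k from any x₀ converges (in norm) to some point of C := ⋂_{i∈I} C_i. -/

import Mathlib

open scoped RealInnerProductSpace

open Filter Topology

section CyclicIntrepidProjections

variable {X : Type*} [NormedAddCommGroup X] [InnerProductSpace ℝ X]

/-- The variational inequality characterizing the metric projection onto a convex set. -/
lemma inner_sub_le_zero_of_dist_eq_infDist {S : Set X} (hS : Convex ℝ S) {x p : X} (hp : p ∈ S)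
    (h : dist x p = Metric.infDist x S) {z : X} (hz : z ∈ S) : ⟪x - p, z - p⟫ ≤ 0 := by
  refine (norm_eq_iInf_iff_real_inner_le_zero hS hp).1 ?_ z hz
  rw [← dist_eq_norm, h, Metric.infDist_eq_iInf]
  simp only [dist_eq_norm]

lemma norm_sub_smul_sub_sq (x p z : X) (t : ℝ) :
    ‖x - t • (x - p) - z‖ ^ 2
      = ‖x - z‖ ^ 2 - 2 * t * (‖x - p‖ ^ 2 - ⟪x - p, z - p⟫) + t ^ 2 * ‖x - p‖ ^ 2 := by
  have h₁ : x - t • (x - p) - z = (x - z) - t • (x - p) := by abel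
  have h₂ : z - p = (x - p) - (x - z) := by abel
  rw [h₁, norm_sub_sq_real, inner_smul_right, norm_smul, mul_pow, Real.norm_eq_abs, sq_abs, h₂,
    inner_sub_right (x - p) (x - p), real_inner_self_eq_norm_sq, real_inner_comm]
  ring

/-- A relaxed projection step decreases the squared distance to every point of the set. -/
lemma relaxed_projection_norm_sq_le {S : Set X} (hS : Convex ℝ S) {x p : X} (hp : p ∈ S)
    (h : dist x p = Metric.infDist x S) {z : X} (hz : z ∈ S) {l : ℝ} (hl : 0 ≤ l) :
    ‖(1 - l) • x + l • p - z‖ ^ 2 ≤ ‖x - z‖ ^ 2 - l * (2 - l) * ‖x - p‖ ^ 2 := by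
  have h₁ : (1 - l) • x + l • p = x - l • (x - p) := by module
  rw [h₁, norm_sub_smul_sub_sq]
  nlinarith [mul_nonneg hl (neg_nonneg.2 (inner_sub_le_zero_of_dist_eq_infDist hS hp h hz))]

/-- A step from `x` towards its projection onto `S` that is at most twice as long as the distance
from `x` to the `b`-enlargement of `S` brings `x` no farther from the points of the enlargement. -/
lemma enlargement_step_norm_le {S : Set X} (hS : Convex ℝ S) {x p z q : X} {b t : ℝ}
    (hp : p ∈ S) (h : dist x p = Metric.infDist x S) (hq : q ∈ S) (hzq : dist z q ≤ b)
    (ht : 0 ≤ t) (htb : t * dist x p ≤ 2 * (dist x p - b)) :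
    ‖x - t • (x - p) - z‖ ≤ ‖x - z‖ := by
  have h₁ := inner_sub_le_zero_of_dist_eq_infDist hS hp h hq
  have h₂ : ⟪x - p, z - p⟫ = ⟪x - p, q - p⟫ + ⟪x - p, z - q⟫ := by
    rw [← inner_add_right]; congr 1; abel
  have h₃ := real_inner_le_norm (x - p) (z - q)
  rw [dist_eq_norm] at hzq htb
  have h₄ := mul_le_mul_of_nonneg_left hzq (norm_nonneg (x - p))
  refine (sq_le_sq₀ (norm_nonneg _) (norm_nonneg _)).1 ?_
  rw [norm_sub_smul_sub_sq]
  have h₅ := mul_le_mul_of_nonneg_left htb (mul_nonneg ht (norm_nonneg (x - p)))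
  have h₆ : ⟪x - p, z - p⟫ ≤ ‖x - p‖ * b := by linarith
  nlinarith [mul_le_mul_of_nonneg_left h₆ ht]

/-- If a step brings `x` no farther from any point of a ball around `c`, then it decreases the
squared distance to `c` in proportion to its length. -/
lemma norm_sub_sq_le_of_forall_closedBall {x w c : X} {r : ℝ} (hr : 0 ≤ r)
    (h : ∀ y ∈ Metric.closedBall c r, ‖w - y‖ ≤ ‖x - y‖) :
    ‖w - c‖ ^ 2 ≤ ‖x - c‖ ^ 2 - 2 * r * ‖w - x‖ := by
  rcases eq_or_ne w x with rfl | hwx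
  · simp
  have hn : 0 < ‖w - x‖ := norm_pos_iff.2 (sub_ne_zero.2 hwx)
  set s : ℝ := r / ‖w - x‖ with hs
  have hsn : s * ‖w - x‖ = r := div_mul_cancel₀ _ hn.ne'
  have hmem : c - s • (w - x) ∈ Metric.closedBall c r := by
    rw [Metric.mem_closedBall, dist_eq_norm, sub_sub_cancel_left, norm_neg, norm_smul,
      Real.norm_of_nonneg (by positivity), hsn]
  have h₁ := pow_le_pow_left₀ (norm_nonneg _) (h _ hmem) 2
  have e₁ : w - (c - s • (w - x)) = (w - c) + s • (w - x) := by abel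
  have e₂ : x - (c - s • (w - x)) = (x - c) + s • (w - x) := by abel
  have e₃ : ⟪w - c, w - x⟫ - ⟪x - c, w - x⟫ = ‖w - x‖ ^ 2 := by
    rw [← inner_sub_left, ← real_inner_self_eq_norm_sq]; congr 1; abel
  rw [e₁, e₂, norm_add_sq_real, norm_add_sq_real, inner_smul_right, inner_smul_right] at h₁
  have h₂ : s * (⟪w - c, w - x⟫ - ⟪x - c, w - x⟫) = r * ‖w - x‖ := by
    rw [e₃, ← hsn]; ring
  linarith

/-- Convergence of quasicyclic iterations of operators `T i` that are Fejér monotone with respect to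
`C i`, uniformly decrease the distance to a common point `c` whenever they make a large step, and
whose displacement controls a continuous function `g i` measuring the violation of `C i`. -/
lemma exists_tendsto_of_quasicyclic [FiniteDimensional ℝ X] {ι : Type*} [Finite ι]
    {C : ι → Set X} {T : ι → X → X} {c : X} (hc : ∀ i, c ∈ C i)
    (hfejer : ∀ i x, ∀ y ∈ C i, ‖T i x - y‖ ≤ ‖x - y‖)
    (hdecr : ∀ i, ∀ ε > 0, ∃ δ > 0, ∀ x, ε ≤ ‖T i x - x‖ →
      ‖T i x - c‖ ^ 2 ≤ ‖x - c‖ ^ 2 - δ)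
    {g : ι → X → ℝ} (hg : ∀ i, Continuous (g i)) (hgC : ∀ i x, g i x ≤ 0 → x ∈ C i)
    (hgT : ∀ i x, g i x ≤ ‖T i x - x‖)
    {sel : ℕ → ι} {M : ℕ} (hqc : ∀ k i, ∃ j < M, sel (k + j) = i)
    {x : ℕ → X} (hx : ∀ k, x (k + 1) = T (sel k) (x k)) :
    ∃ y ∈ ⋂ i, C i, Tendsto x atTop (𝓝 y) := by
  have hanti : ∀ y, (∀ i, y ∈ C i) → Antitone fun k => ‖x k - y‖ := fun y hy =>
    antitone_nat_of_succ_le fun k => by rw [hx]; exact hfejer _ _ _ (hy _)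
  have hstep : Tendsto (fun k => ‖x (k + 1) - x k‖) atTop (𝓝 0) := by
    have hlim := tendsto_atTop_ciInf (hanti c hc) ⟨0, by rintro _ ⟨k, rfl⟩; exact norm_nonneg _⟩
    have hsq := hlim.pow 2
    have hdiff := hsq.sub (hsq.comp (tendsto_add_atTop_nat 1))
    rw [sub_self] at hdiff
    refine (tendsto_order.2 ⟨fun a ha => Eventually.of_forall fun k => ha.trans_le (norm_nonneg _),
      fun ε hε => ?_⟩)
    have hall : ∀ i, ∀ᶠ k in atTop, sel k = i → ‖x (k + 1) - x k‖ < ε := fun i => by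
      obtain ⟨δ, hδ, h⟩ := hdecr i ε hε
      filter_upwards [hdiff.eventually_lt_const hδ] with k hk hki
      by_contra! hlt
      have := h (x k)
      rw [← hki, ← hx] at this
      have := this hlt
      simp only [Function.comp_apply] at hk
      linarith
    filter_upwards [eventually_all.2 hall] with k hk using hk _ rfl
  have hmulti : ∀ j, Tendsto (fun k => ‖x (k + j) - x k‖) atTop (𝓝 0) := fun j => by
    induction j with
    | zero => simp
    | succ j ih =>
      have hs := (hstep.comp (tendsto_add_atTop_nat j)).add ih
      rw [add_zero] at hs
      refine squeeze_zero (fun k => norm_nonneg _) (fun k => ?_) hs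
      exact norm_sub_le_norm_sub_add_norm_sub _ _ _
  obtain ⟨y, -, φ, hφ, hy⟩ := tendsto_subseq_of_bounded (Metric.isBounded_closedBall
    (x := c) (r := ‖x 0 - c‖)) (x := x) fun k => by
      rw [Metric.mem_closedBall, dist_eq_norm]; exact hanti c hc (Nat.zero_le k)
  have hyC : ∀ i, y ∈ C i := fun i => by
    choose j hjM hj using fun n => hqc (φ n) i
    have hidx : Tendsto (fun n => φ n + j n) atTop atTop :=
      tendsto_atTop_mono (fun n => Nat.le_add_right _ _) hφ.tendsto_atTop
    have hsum : Tendsto (fun n => ∑ l ∈ Finset.range M, ‖x (φ n + l) - x (φ n)‖) atTop (𝓝 0) := by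
      simpa using tendsto_finsetSum (Finset.range M)
        fun l _ => (hmulti l).comp hφ.tendsto_atTop
    have hdist : Tendsto (fun n => x (φ n + j n) - x (φ n)) atTop (𝓝 0) :=
      squeeze_zero_norm (fun n => Finset.single_le_sum
        (f := fun l => ‖x (φ n + l) - x (φ n)‖) (fun _ _ => norm_nonneg _)
        (Finset.mem_range.2 (hjM n))) hsum
    have hxy : Tendsto (fun n => x (φ n + j n)) atTop (𝓝 y) := by
      simpa using hdist.add hy
    refine hgC i y (le_of_tendsto_of_tendsto' (((hg i).tendsto y).comp hxy)
      (hstep.comp hidx) fun n => ?_)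
    have := hgT i (x (φ n + j n))
    rwa [← hj n, ← hx, hj n] at this
  refine ⟨y, Set.mem_iInter.2 hyC, tendsto_iff_norm_sub_tendsto_zero.2 ?_⟩
  exact (tendsto_iff_tendsto_subseq_of_antitone (hanti y hyC) hφ.tendsto_atTop).2
    (tendsto_iff_norm_sub_tendsto_zero.1 hy)

/-- Each intrepid projector moves `x` along the segment towards the projection onto the core set, by
at most twice the distance to the enlargement and by at least that distance. -/
lemma intrepid_step {S : Set X} {b : ℝ} (hb : 0 < b) {x p w : X}
    (hp : dist x p = Metric.infDist x S)
    (hfar : 2 * b ≤ Metric.infDist x S → w = p)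
    (hmid : b < Metric.infDist x S → Metric.infDist x S < 2 * b →
      w = x + (1 - Metric.infDist x S / b) • (x - p))
    (hx : b < Metric.infDist x S) :
    ∃ t : ℝ, 0 ≤ t ∧ w = x - t • (x - p) ∧ t * dist x p ≤ 2 * (dist x p - b) ∧
      dist x p - b ≤ t * dist x p := by
  rw [← hp] at hfar hmid hx
  rcases le_or_gt (2 * b) (dist x p) with h | h
  · refine ⟨1, zero_le_one, by rw [hfar h]; simp, by linarith, by linarith⟩
  · set d := dist x p
    have e : d / b * b = d := div_mul_cancel₀ _ hb.ne'
    have h₁ : 1 ≤ d / b := (one_le_div hb).2 hx.le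
    have h₂ : d / b ≤ 2 := (div_le_iff₀ hb).2 h.le
    refine ⟨d / b - 1, by linarith, ?_, ?_, ?_⟩
    · rw [hmid hx h]; module
    · nlinarith [mul_nonneg (sub_nonneg.2 hx.le) (sub_nonneg.2 h₂)]
    · nlinarith [mul_nonneg (sub_nonneg.2 hx.le) (sub_nonneg.2 h₁)]

end CyclicIntrepidProjections

/-- main result, finite dimensions: norm convergence.
CycIP setup in a finite-dimensional real Hilbert space.  Suppose
`⋂_{i∈I₁} C i ∩ ⋂_{i∈I₀} int (C i) ≠ ∅` and the control is quasicyclic with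
quasiperiod `M ≥ 1`.  Then the generated sequence converges in norm to some
point of `C := ⋂ i, C i`. -/
theorem cycIP_main_finite_dimensional_convergence
    {X : Type*} [NormedAddCommGroup X] [InnerProductSpace ℝ X] [CompleteSpace X]
    [FiniteDimensional ℝ X]
    {ι : Type*} [Fintype ι] [Nonempty ι] (I₀ : Set ι)
    (C : ι → Set X)
    (hC : ∀ i, (C i).Nonempty ∧ IsClosed (C i) ∧ Convex ℝ (C i))
    (Z : ι → Set X) (β : ι → ℝ) (PZ : ι → X → X)
    (hI₀ : ∀ i ∈ I₀, (Z i).Nonempty ∧ IsClosed (Z i) ∧ Convex ℝ (Z i) ∧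
      0 < β i ∧ C i = {x : X | Metric.infDist x (Z i) ≤ β i} ∧
      ∀ x : X, PZ i x ∈ Z i ∧ dist x (PZ i x) = Metric.infDist x (Z i))
    (lam : ι → ℝ) (PC : ι → X → X)
    (hI₁ : ∀ i ∉ I₀, lam i ∈ Set.Ioo (0 : ℝ) 2 ∧
      ∀ x : X, PC i x ∈ C i ∧ dist x (PC i x) = Metric.infDist x (C i))
    (T : ι → X → X)
    (hT₀ : ∀ i ∈ I₀, ∀ x : X,
      (2 * β i ≤ Metric.infDist x (Z i) → T i x = PZ i x) ∧
      (Metric.infDist x (Z i) ≤ β i → T i x = x) ∧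
      (β i < Metric.infDist x (Z i) → Metric.infDist x (Z i) < 2 * β i →
        T i x = x + (1 - Metric.infDist x (Z i) / β i) • (x - PZ i x)))
    (hT₁ : ∀ i ∉ I₀, ∀ x : X, T i x = (1 - lam i) • x + lam i • PC i x)
    (hfeas : ((⋂ i ∈ I₀ᶜ, C i) ∩ ⋂ i ∈ I₀, interior (C i)).Nonempty)
    (sel : ℕ → ι) (hsel : ∀ i, {k : ℕ | sel k = i}.Infinite)
    (M : ℕ) (hM : 1 ≤ M)
    (hqc : ∀ k : ℕ, ∀ i : ι, ∃ j < M, sel (k + j) = i)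
    (x : ℕ → X) (hx : ∀ k : ℕ, x (k + 1) = T (sel k) (x k)) :
    ∃ xbar ∈ ⋂ i, C i, Filter.Tendsto x Filter.atTop (nhds xbar) := by
  obtain ⟨c, hc₁, hc₀⟩ := hfeas
  simp only [Set.mem_iInter, Set.mem_compl_iff] at hc₁ hc₀
  have hc : ∀ i, c ∈ C i := fun i => by
    by_cases hi : i ∈ I₀
    · exact interior_subset (hc₀ i hi)
    · exact hc₁ i hi
  have hfejer : ∀ i x, ∀ y ∈ C i, ‖T i x - y‖ ≤ ‖x - y‖ := fun i x y hy => by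
    by_cases hi : i ∈ I₀
    · obtain ⟨-, -, hconv, hβ, hCi, hP⟩ := hI₀ i hi
      obtain ⟨hfar, hnear, hmid⟩ := hT₀ i hi x
      rcases le_or_gt (Metric.infDist x (Z i)) (β i) with h | h
      · rw [hnear h]
      · obtain ⟨t, ht, hw, ht₂, -⟩ := intrepid_step hβ (hP x).2 hfar hmid h
        rw [hCi, Set.mem_ofPred_eq, ← (hP y).2] at hy
        rw [hw]
        exact enlargement_step_norm_le hconv (hP x).1 (hP x).2 (hP y).1 hy ht ht₂
    · obtain ⟨⟨hl₀, hl₂⟩, hP⟩ := hI₁ i hi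
      have h := relaxed_projection_norm_sq_le (hC i).2.2 (hP x).1 (hP x).2 hy hl₀.le
      rw [hT₁ i hi]
      refine (sq_le_sq₀ (norm_nonneg _) (norm_nonneg _)).1 (h.trans (sub_le_self _ ?_))
      have := sub_pos.2 hl₂
      positivity
  have hdisp : ∀ i ∉ I₀, ∀ x, ‖T i x - x‖ = lam i * ‖x - PC i x‖ := fun i hi x => by
    have e : T i x - x = -(lam i • (x - PC i x)) := by rw [hT₁ i hi]; module
    rw [e, norm_neg, norm_smul, Real.norm_of_nonneg (hI₁ i hi).1.1.le]
  have hdecr : ∀ i, ∀ ε > 0, ∃ δ > 0, ∀ x, ε ≤ ‖T i x - x‖ →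
      ‖T i x - c‖ ^ 2 ≤ ‖x - c‖ ^ 2 - δ := fun i ε hε => by
    by_cases hi : i ∈ I₀
    · obtain ⟨r, hr, hball⟩ := Metric.nhds_basis_closedBall.mem_iff.1
        (mem_interior_iff_mem_nhds.1 (hc₀ i hi))
      refine ⟨2 * r * ε, by positivity, fun x hx => ?_⟩
      have h := norm_sub_sq_le_of_forall_closedBall hr.le fun y hy => hfejer i x y (hball hy)
      have := mul_le_mul_of_nonneg_left hx (by positivity : 0 ≤ 2 * r)
      linarith
    · obtain ⟨⟨hl₀, hl₂⟩, hP⟩ := hI₁ i hi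
      have hl := sub_pos.2 hl₂
      refine ⟨lam i * (2 - lam i) * (ε / lam i) ^ 2, by positivity, fun x hx => ?_⟩
      have h := relaxed_projection_norm_sq_le (hC i).2.2 (hP x).1 (hP x).2 (hc i) hl₀.le
      rw [hT₁ i hi]
      refine h.trans (sub_le_sub_left ?_ _)
      rw [hdisp i hi, ← div_le_iff₀' hl₀] at hx
      gcongr
  have hviol : ∀ i, ∃ g : X → ℝ, Continuous g ∧ (∀ x, g x ≤ 0 → x ∈ C i) ∧
      ∀ x, g x ≤ ‖T i x - x‖ := fun i => by
    by_cases hi : i ∈ I₀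
    · obtain ⟨-, -, -, hβ, hCi, hP⟩ := hI₀ i hi
      refine ⟨fun x => Metric.infDist x (Z i) - β i,
        (Metric.continuous_infDist_pt _).sub continuous_const, fun x hx => ?_, fun x => ?_⟩
      · rw [hCi]; exact sub_nonpos.1 hx
      · obtain ⟨hfar, -, hmid⟩ := hT₀ i hi x
        rcases le_or_gt (Metric.infDist x (Z i)) (β i) with h | h
        · exact (sub_nonpos.2 h).trans (norm_nonneg _)
        · obtain ⟨t, ht, hw, -, ht₁⟩ := intrepid_step hβ (hP x).2 hfar hmid h
          rw [(hP x).2] at ht₁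
          rwa [hw, sub_sub_cancel_left, norm_neg, norm_smul, Real.norm_of_nonneg ht,
            ← dist_eq_norm, (hP x).2]
    · obtain ⟨⟨hl₀, -⟩, hP⟩ := hI₁ i hi
      refine ⟨fun x => lam i * Metric.infDist x (C i),
        continuous_const.mul (Metric.continuous_infDist_pt _), fun x hx => ?_, fun x => ?_⟩
      · rw [(hC i).2.1.mem_iff_infDist_zero (hC i).1]
        exact le_antisymm (nonpos_of_mul_nonpos_right hx hl₀) Metric.infDist_nonneg
      · rw [hdisp i hi, ← dist_eq_norm, (hP x).2]
  choose g hg hgC hgT using hviol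
  exact exists_tendsto_of_quasicyclic hc hfejer hdecr hg hgC hgT hqc hx
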